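/- arXiv:2307.01637 — 2 statements merged into one kernel-verified Lean document; each statement's English description precedes it below -/
import Mathlib

section
/- Under the multiplex RWM recursion, for every tolerance ε with 0 < ε < 1, every network index i, and every natural number t with t > log(ε/K)/log(λ), the modified transition matrices satisfy ‖𝒫_i^{(t+1)} − 𝒫_i^{(t)}‖_∞ < ε. -/
open Finset Filter Matrix Topology

/-- Cosine similarity of two vectors in `ℝ^n` (0 when a denominator vanishes,
since division by zero is 0 in Lean). -/
noncomputable def cosSim {n : ℕ} (u v : Fin n → ℝ) : ℝ :=
  (∑ k, u k * v k) / (Real.sqrt (∑ k, u k * u k) * Real.sqrt (∑ k, v k * v k))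

/-- The maximum of the absolute values of the entries of a real matrix. -/
noncomputable def matInfNorm {m n : ℕ} (M : Matrix (Fin m) (Fin n) ℝ) : ℝ :=
  ⨆ p : Fin m × Fin n, |M p.1 p.2|

/-- The joint state `(W^{(t)}, x^{(t)})` of the multiplex RWM recursion:
`W^{(0)} = I`, `x^{(0)}` given; `Ŵ^{(t)}(i,j) = W^{(t)}(i,j)/∑_k W^{(t)}(i,k)`,
`𝒫_i^{(t)} = ∑_j Ŵ^{(t)}(i,j) P_j`, `x_i^{(t+1)} = 𝒫_i^{(t)} x_i^{(t)}`, and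
`W^{(t+1)}(i,j) = W^{(t)}(i,j) + λ^{t+1} cos(x_i^{(t+1)}, x_j^{(t+1)})`. -/
noncomputable def rwmState {K n : ℕ} (lam : ℝ) (P : Fin K → Matrix (Fin n) (Fin n) ℝ)
    (x0 : Fin K → Fin n → ℝ) : ℕ → Matrix (Fin K) (Fin K) ℝ × (Fin K → Fin n → ℝ)
  | 0 => (1, x0)
  | t + 1 =>
      let Wt := (rwmState lam P x0 t).1
      let xt := (rwmState lam P x0 t).2
      let What : Matrix (Fin K) (Fin K) ℝ := Matrix.of fun i j => Wt i j / ∑ k, Wt i k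
      let Pmod : Fin K → Matrix (Fin n) (Fin n) ℝ := fun i => ∑ j, What i j • P j
      let xNew : Fin K → Fin n → ℝ := fun i => (Pmod i).mulVec (xt i)
      (Matrix.of fun i j => Wt i j + lam ^ (t + 1) * cosSim (xNew i) (xNew j), xNew)

/-- The relevance weight matrix `W^{(t)}`. -/
noncomputable def rwmW {K n : ℕ} (lam : ℝ) (P : Fin K → Matrix (Fin n) (Fin n) ℝ)
    (x0 : Fin K → Fin n → ℝ) (t : ℕ) : Matrix (Fin K) (Fin K) ℝ :=
  (rwmState lam P x0 t).1

/-- The visiting probability vector `x_i^{(t)}`. -/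
noncomputable def rwmX {K n : ℕ} (lam : ℝ) (P : Fin K → Matrix (Fin n) (Fin n) ℝ)
    (x0 : Fin K → Fin n → ℝ) (t : ℕ) (i : Fin K) : Fin n → ℝ :=
  (rwmState lam P x0 t).2 i

/-- The row-normalized relevance weight matrix `Ŵ^{(t)}`. -/
noncomputable def rwmWhat {K n : ℕ} (lam : ℝ) (P : Fin K → Matrix (Fin n) (Fin n) ℝ)
    (x0 : Fin K → Fin n → ℝ) (t : ℕ) : Matrix (Fin K) (Fin K) ℝ :=
  Matrix.of fun i j => rwmW lam P x0 t i j / ∑ k, rwmW lam P x0 t i k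

/-- The modified transition matrix `𝒫_i^{(t)} = ∑_j Ŵ^{(t)}(i,j) P_j`. -/
noncomputable def rwmPmod {K n : ℕ} (lam : ℝ) (P : Fin K → Matrix (Fin n) (Fin n) ℝ)
    (x0 : Fin K → Fin n → ℝ) (t : ℕ) (i : Fin K) : Matrix (Fin n) (Fin n) ℝ :=
  ∑ j, rwmWhat lam P x0 t i j • P j

theorem cosSim_nonneg {n : ℕ} {u v : Fin n → ℝ} (hu : ∀ k, 0 ≤ u k) (hv : ∀ k, 0 ≤ v k) :
    0 ≤ cosSim u v :=
  div_nonneg (Finset.sum_nonneg fun k _ => mul_nonneg (hu k) (hv k)) (by positivity)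

theorem cosSim_le_one {n : ℕ} (u v : Fin n → ℝ) : cosSim u v ≤ 1 := by
  refine div_le_one_of_le₀ ?_ (by positivity)
  simpa only [pow_two] using Real.sum_mul_le_sqrt_mul_sqrt Finset.univ u v

theorem rwmX_succ {K n : ℕ} (lam : ℝ) (P : Fin K → Matrix (Fin n) (Fin n) ℝ)
    (x0 : Fin K → Fin n → ℝ) (t : ℕ) (i : Fin K) :
    rwmX lam P x0 (t + 1) i = (rwmPmod lam P x0 t i).mulVec (rwmX lam P x0 t i) :=
  rfl

theorem rwmW_succ {K n : ℕ} (lam : ℝ) (P : Fin K → Matrix (Fin n) (Fin n) ℝ)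
    (x0 : Fin K → Fin n → ℝ) (t : ℕ) (i j : Fin K) :
    rwmW lam P x0 (t + 1) i j = rwmW lam P x0 t i j +
      lam ^ (t + 1) * cosSim (rwmX lam P x0 (t + 1) i) (rwmX lam P x0 (t + 1) j) :=
  rfl

theorem rwmPmod_apply {K n : ℕ} (lam : ℝ) (P : Fin K → Matrix (Fin n) (Fin n) ℝ)
    (x0 : Fin K → Fin n → ℝ) (t : ℕ) (i : Fin K) (v u : Fin n) :
    rwmPmod lam P x0 t i v u =
      (∑ j, rwmW lam P x0 t i j * P j v u) / ∑ k, rwmW lam P x0 t i k := by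
  simp only [rwmPmod, rwmWhat, Matrix.sum_apply, Matrix.smul_apply, Matrix.of_apply,
    smul_eq_mul, Finset.sum_div]
  exact Finset.sum_congr rfl fun j _ => by ring

/-- The relevance weights and the visiting vectors stay nonnegative, and each network keeps
weight at least `1` on itself. -/
theorem rwm_nonneg {K n : ℕ} {lam : ℝ} (hlam : 0 ≤ lam)
    {P : Fin K → Matrix (Fin n) (Fin n) ℝ} (hP : ∀ j v u, 0 ≤ P j v u)
    {x0 : Fin K → Fin n → ℝ} (hx0 : ∀ i v, 0 ≤ x0 i v) (t : ℕ) :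
    (∀ i j, 0 ≤ rwmW lam P x0 t i j) ∧ (∀ i, 1 ≤ rwmW lam P x0 t i i) ∧
      ∀ i v, 0 ≤ rwmX lam P x0 t i v := by
  induction t with
  | zero =>
    refine ⟨fun i j => ?_, fun i => ?_, hx0⟩
    · change 0 ≤ (1 : Matrix (Fin K) (Fin K) ℝ) i j
      rw [Matrix.one_apply]
      split_ifs <;> norm_num
    · change 1 ≤ (1 : Matrix (Fin K) (Fin K) ℝ) i i
      rw [Matrix.one_apply_eq]
  | succ t ih =>
    obtain ⟨hW, hdiag, hX⟩ := ih
    have hX' : ∀ i v, 0 ≤ rwmX lam P x0 (t + 1) i v := by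
      intro i v
      rw [rwmX_succ, Matrix.mulVec, dotProduct]
      refine Finset.sum_nonneg fun u _ => mul_nonneg ?_ (hX i u)
      rw [rwmPmod_apply]
      exact div_nonneg (Finset.sum_nonneg fun j _ => mul_nonneg (hW i j) (hP j v u))
        (Finset.sum_nonneg fun k _ => hW i k)
    have hinc : ∀ i j, 0 ≤ lam ^ (t + 1) *
        cosSim (rwmX lam P x0 (t + 1) i) (rwmX lam P x0 (t + 1) j) := fun i j =>
      mul_nonneg (pow_nonneg hlam _) (cosSim_nonneg (hX' i) (hX' j))
    refine ⟨fun i j => ?_, fun i => ?_, hX'⟩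
    · rw [rwmW_succ]
      exact add_nonneg (hW i j) (hinc i j)
    · rw [rwmW_succ]
      linarith [hdiag i, hinc i i]

/-- Adding nonnegative weights of total mass `C` to nonnegative weights of total mass at least
`1` changes a weighted mean of numbers in `[0, 1]` by at most `C`. -/
theorem abs_weighted_mean_sub_le {ι : Type*} (s : Finset ι) {w c p : ι → ℝ}
    (hw : ∀ j ∈ s, 0 ≤ w j) (hc : ∀ j ∈ s, 0 ≤ c j) (hp0 : ∀ j ∈ s, 0 ≤ p j)
    (hp1 : ∀ j ∈ s, p j ≤ 1) (hS : 1 ≤ ∑ j ∈ s, w j) :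
    |(∑ j ∈ s, (w j + c j) * p j) / ∑ j ∈ s, (w j + c j) -
      (∑ j ∈ s, w j * p j) / ∑ j ∈ s, w j| ≤ ∑ j ∈ s, c j := by
  have hA0 : 0 ≤ ∑ j ∈ s, w j * p j :=
    Finset.sum_nonneg fun j hj => mul_nonneg (hw j hj) (hp0 j hj)
  have hB0 : 0 ≤ ∑ j ∈ s, c j * p j :=
    Finset.sum_nonneg fun j hj => mul_nonneg (hc j hj) (hp0 j hj)
  have hA1 : ∑ j ∈ s, w j * p j ≤ ∑ j ∈ s, w j :=
    Finset.sum_le_sum fun j hj => mul_le_of_le_one_right (hw j hj) (hp1 j hj)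
  have hB1 : ∑ j ∈ s, c j * p j ≤ ∑ j ∈ s, c j :=
    Finset.sum_le_sum fun j hj => mul_le_of_le_one_right (hc j hj) (hp1 j hj)
  have hC : 0 ≤ ∑ j ∈ s, c j := Finset.sum_nonneg hc
  simp only [add_mul, Finset.sum_add_distrib]
  generalize (∑ j ∈ s, w j * p j) = A at *
  generalize (∑ j ∈ s, c j * p j) = B at *
  generalize (∑ j ∈ s, w j) = S at *
  generalize (∑ j ∈ s, c j) = C at *
  have hS0 : 0 < S := by linarith
  have hm0 : 0 ≤ A / S := div_nonneg hA0 hS0.le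
  have hm1 : A / S ≤ 1 := div_le_one_of_le₀ hA1 hS0.le
  have hsub : (A + B) / (S + C) - A / S = (B - C * (A / S)) / (S + C) := by
    have : S + C ≠ 0 := by linarith
    field_simp
    ring
  have hnum : |B - C * (A / S)| ≤ C :=
    abs_sub_le_of_nonneg_of_le hB0 hB1 (mul_nonneg hC hm0) (mul_le_of_le_one_right hC hm1)
  rw [hsub, abs_div, abs_of_pos (show 0 < S + C by linarith)]
  exact (div_le_self (abs_nonneg _) (by linarith)).trans hnum

theorem matInfNorm_rwmPmod_succ_sub_le {K n : ℕ} {lam : ℝ} (hlam : 0 ≤ lam)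
    {P : Fin K → Matrix (Fin n) (Fin n) ℝ} (hP : ∀ j v u, 0 ≤ P j v u)
    (hPcol : ∀ j u, ∑ v, P j v u = 1) {x0 : Fin K → Fin n → ℝ} (hx0 : ∀ i v, 0 ≤ x0 i v)
    (t : ℕ) (i : Fin K) :
    matInfNorm (rwmPmod lam P x0 (t + 1) i - rwmPmod lam P x0 t i) ≤ K * lam ^ (t + 1) := by
  obtain ⟨hW, hdiag, -⟩ := rwm_nonneg hlam hP hx0 t
  obtain ⟨-, -, hX⟩ := rwm_nonneg hlam hP hx0 (t + 1)
  have hpow : 0 ≤ lam ^ (t + 1) := pow_nonneg hlam _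
  refine Real.iSup_le (fun ⟨v, u⟩ => ?_) (by positivity)
  have hP1 : ∀ j, P j v u ≤ 1 := fun j => by
    rw [← hPcol j u]
    exact Finset.single_le_sum (f := fun v => P j v u) (fun v _ => hP j v u)
      (Finset.mem_univ v)
  rw [Matrix.sub_apply, rwmPmod_apply, rwmPmod_apply]
  simp only [rwmW_succ]
  refine (abs_weighted_mean_sub_le Finset.univ (fun j _ => hW i j)
    (fun j _ => mul_nonneg hpow (cosSim_nonneg (hX i) (hX j)))
    (fun j _ => hP j v u) (fun j _ => hP1 j) ?_).trans ?_
  · exact (hdiag i).trans (Finset.single_le_sum (f := fun j => rwmW lam P x0 t i j)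
      (fun j _ => hW i j) (Finset.mem_univ i))
  · refine (Finset.sum_le_sum fun j _ =>
      mul_le_of_le_one_right hpow (cosSim_le_one _ _)).trans ?_
    simp

/-- Under the multiplex RWM recursion, for every tolerance `ε` with `0 < ε < 1`, every
network index `i`, and every natural number `t` with `t > log(ε/K)/log λ`, the modified
transition matrices satisfy `‖𝒫_i^{(t+1)} − 𝒫_i^{(t)}‖_∞ < ε`. -/
theorem rwm_multiplex_transition_convergence
    (K n : ℕ) (hK : 1 ≤ K) (hn : 1 ≤ n)
    (lam : ℝ) (hlam0 : 0 < lam) (hlam1 : lam < 1)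
    (P : Fin K → Matrix (Fin n) (Fin n) ℝ)
    (hPnn : ∀ j v u, 0 ≤ P j v u) (hPcol : ∀ j u, ∑ v, P j v u = 1)
    (x0 : Fin K → Fin n → ℝ)
    (hx0nn : ∀ i v, 0 ≤ x0 i v) (hx0sum : ∀ i, ∑ v, x0 i v = 1) :
    ∀ ε : ℝ, 0 < ε → ε < 1 → ∀ i : Fin K, ∀ t : ℕ,
      (t : ℝ) > Real.log (ε / K) / Real.log lam →
      matInfNorm (rwmPmod lam P x0 (t + 1) i - rwmPmod lam P x0 t i) < ε := by
  intro ε hε _ i t ht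
  have hK0 : (0 : ℝ) < K := by exact_mod_cast hK
  have hlog : (t : ℝ) * Real.log lam < Real.log (ε / K) :=
    (div_lt_iff_of_neg (Real.log_neg hlam0 hlam1)).1 ht
  rw [← Real.log_pow] at hlog
  have hpow : lam ^ t < ε / K :=
    (Real.log_lt_log_iff (pow_pos hlam0 t) (div_pos hε hK0)).1 hlog
  calc matInfNorm (rwmPmod lam P x0 (t + 1) i - rwmPmod lam P x0 t i)
      ≤ K * lam ^ (t + 1) := matInfNorm_rwmPmod_succ_sub_le hlam0.le hPnn hPcol hx0nn t i
    _ ≤ K * lam ^ t := by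
      gcongr ?_ * ?_
      exact pow_le_pow_of_le_one hlam0.le hlam1.le t.le_succ
    _ < ε := (lt_div_iff₀' hK0).1 hpow
end

section
/- Let A_t (t ∈ ℕ) and A be real n×n column-stochastic matrices (all entries nonnegative and every column sums to 1) such that A_t converges to A entrywise as t → ∞. Let 0 < α < 1 and let x⁰ ∈ ℝ^n. Define x_0 = x⁰ and x_{t+1} = α·(A_t x_t) + (1−α)·x⁰. Then the sequence x_t converges as t → ∞ to the unique vector x* satisfying x* = α·(A x*) + (1−α)·x⁰. -/
open Filter Matrix Topology

/-- The time-inhomogeneous restart iteration `x_{t+1} = α A_t x_t + (1−α) x⁰`, `x_0 = x⁰`. -/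
noncomputable def rwrSeqVar {n : ℕ} (A : ℕ → Matrix (Fin n) (Fin n) ℝ) (α : ℝ)
    (x0 : Fin n → ℝ) : ℕ → Fin n → ℝ
  | 0 => x0
  | t + 1 => α • (A t).mulVec (rwrSeqVar A α x0 t) + (1 - α) • x0

/-- A nonnegative sequence contracting up to a vanishing perturbation tends to zero. -/
theorem tendsto_zero_of_le_mul_add {u d : ℕ → ℝ} {α : ℝ} (hα0 : 0 ≤ α) (hα1 : α < 1)
    (hu : ∀ t, 0 ≤ u t) (hrec : ∀ t, u (t + 1) ≤ α * u t + d t)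
    (hd : Tendsto d atTop (𝓝 0)) : Tendsto u atTop (𝓝 0) := by
  refine tendsto_order.2 ⟨fun a ha => Eventually.of_forall fun t => ha.trans_le (hu t),
    fun ε hε => ?_⟩
  have hpos : 0 < (1 - α) * (ε / 2) := mul_pos (by linarith) (by linarith)
  obtain ⟨T, hT⟩ := eventually_atTop.1 (hd.eventually_lt_const hpos)
  have hbound : ∀ k, u (k + T) ≤ α ^ k * u T + ε / 2 := by
    intro k
    induction k with
    | zero => simp; linarith
    | succ k ih =>
      have h1 := hrec (k + T)
      have h2 := hT (k + T) (Nat.le_add_left T k)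
      have h3 := mul_le_mul_of_nonneg_left ih hα0
      rw [show k + 1 + T = k + T + 1 by ring, pow_succ]
      linarith
  have hpow : Tendsto (fun k => α ^ k * u T) atTop (𝓝 0) := by
    simpa using (tendsto_pow_atTop_nhds_zero_of_lt_one hα0 hα1).mul_const (u T)
  have hev : ∀ᶠ k in atTop, u (k + T) < ε := by
    filter_upwards [hpow.eventually_lt_const (half_pos hε)] with k hk
    linarith [hbound k]
  obtain ⟨K, hK⟩ := eventually_atTop.1 hev
  refine eventually_atTop.2 ⟨K + T, fun t ht => ?_⟩
  have h := hK (t - T) (by omega)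
  rwa [Nat.sub_add_cancel (by omega)] at h

/-- A column-stochastic matrix does not increase the `ℓ¹` norm. -/
theorem sum_abs_mulVec_le {ι : Type*} [Fintype ι] {B : Matrix ι ι ℝ}
    (hnn : ∀ v u, 0 ≤ B v u) (hcol : ∀ u, ∑ v, B v u = 1) (x : ι → ℝ) :
    ∑ v, |(B *ᵥ x) v| ≤ ∑ v, |x v| := by
  calc ∑ v, |(B *ᵥ x) v| ≤ ∑ v, ∑ u, B v u * |x u| := by
        refine Finset.sum_le_sum fun v _ => (Finset.abs_sum_le_sum_abs _ _).trans_eq ?_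
        exact Finset.sum_congr rfl fun u _ => by rw [abs_mul, abs_of_nonneg (hnn v u)]
    _ = ∑ u, |x u| := by
        rw [Finset.sum_comm]
        simp_rw [← Finset.sum_mul, hcol, one_mul]

/-- For column-stochastic `B` and `0 ≤ α < 1`, the only solution of `x = α B x` is zero. -/
theorem eq_zero_of_eq_smul_mulVec {ι : Type*} [Fintype ι] {B : Matrix ι ι ℝ}
    (hnn : ∀ v u, 0 ≤ B v u) (hcol : ∀ u, ∑ v, B v u = 1) {α : ℝ} (hα0 : 0 ≤ α)
    (hα1 : α < 1) {x : ι → ℝ} (hx : x = α • B *ᵥ x) : x = 0 := by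
  have h1 : ∑ v, |x v| = α * ∑ v, |(B *ᵥ x) v| := by
    rw [Finset.mul_sum]
    refine Finset.sum_congr rfl fun v _ => ?_
    conv_lhs => rw [hx]
    rw [Pi.smul_apply, smul_eq_mul, abs_mul, abs_of_nonneg hα0]
  have h2 := mul_le_mul_of_nonneg_left (sum_abs_mulVec_le hnn hcol x) hα0
  have h3 : 0 ≤ ∑ v, |x v| := Finset.sum_nonneg fun v _ => abs_nonneg _
  have h4 : ∑ v, |x v| = 0 := by nlinarith
  funext v
  exact abs_eq_zero.1
    ((Finset.sum_eq_zero_iff_of_nonneg fun v _ => abs_nonneg (x v)).1 h4 v (Finset.mem_univ v))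

/-- If column-stochastic matrices `A_t` converge entrywise to a column-stochastic `A`,
then the restart iteration `x_{t+1} = α A_t x_t + (1−α) x⁰` converges to the unique
vector `x*` with `x* = α A x* + (1−α) x⁰`. -/
theorem inhomogeneous_rwr_iteration_converges
    (n : ℕ) (A : ℕ → Matrix (Fin n) (Fin n) ℝ) (Alim : Matrix (Fin n) (Fin n) ℝ)
    (hAnn : ∀ t v u, 0 ≤ A t v u) (hAcol : ∀ t u, ∑ v, A t v u = 1)
    (hlimnn : ∀ v u, 0 ≤ Alim v u) (hlimcol : ∀ u, ∑ v, Alim v u = 1)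
    (hconv : ∀ v u, Tendsto (fun t => A t v u) atTop (𝓝 (Alim v u)))
    (α : ℝ) (hα0 : 0 < α) (hα1 : α < 1) (x0 : Fin n → ℝ) :
    ∃ xs : Fin n → ℝ,
      (xs = α • Alim.mulVec xs + (1 - α) • x0) ∧
      (∀ y : Fin n → ℝ, y = α • Alim.mulVec y + (1 - α) • x0 → y = xs) ∧
      Tendsto (rwrSeqVar A α x0) atTop (𝓝 xs) := by
  have hinj : Function.Injective
      (LinearMap.id - α • Alim.mulVecLin : (Fin n → ℝ) →ₗ[ℝ] Fin n → ℝ) := by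
    refine (injective_iff_map_eq_zero _).2 fun x hx => ?_
    exact eq_zero_of_eq_smul_mulVec hlimnn hlimcol hα0.le hα1 (sub_eq_zero.1 hx)
  obtain ⟨xs, hxs⟩ := LinearMap.injective_iff_surjective.1 hinj ((1 - α) • x0)
  have hfix : xs = α • Alim.mulVec xs + (1 - α) • x0 := by
    rw [← hxs]
    simp
  refine ⟨xs, hfix, fun y hy => ?_, ?_⟩
  · refine sub_eq_zero.1 (eq_zero_of_eq_smul_mulVec hlimnn hlimcol hα0.le hα1 ?_)
    conv_lhs => rw [hy, hfix]
    rw [mulVec_sub, smul_sub]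
    abel
  · have hstep : ∀ t, rwrSeqVar A α x0 (t + 1) - xs =
        α • (A t *ᵥ (rwrSeqVar A α x0 t - xs) + (A t *ᵥ xs - Alim *ᵥ xs)) := by
      intro t
      conv_lhs => rw [hfix, rwrSeqVar]
      rw [mulVec_sub, sub_add_sub_cancel, smul_sub]
      abel
    have hpert : Tendsto (fun t => α * ∑ v, |(A t *ᵥ xs - Alim *ᵥ xs) v|) atTop (𝓝 0) := by
      have hv : ∀ v, Tendsto (fun t => |(A t *ᵥ xs - Alim *ᵥ xs) v|) atTop (𝓝 0) := by
        intro v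
        have h : Tendsto (fun t => (A t *ᵥ xs) v) atTop (𝓝 ((Alim *ᵥ xs) v)) :=
          tendsto_finsetSum Finset.univ fun u _ => (hconv v u).mul_const (xs u)
        simpa using (h.sub_const ((Alim *ᵥ xs) v)).abs
      simpa using (tendsto_finsetSum Finset.univ fun v _ => hv v).const_mul α
    have herr : Tendsto (fun t => ∑ v, |(rwrSeqVar A α x0 t - xs) v|) atTop (𝓝 0) := by
      refine tendsto_zero_of_le_mul_add hα0.le hα1
        (fun t => Finset.sum_nonneg fun v _ => abs_nonneg _) (fun t => ?_) hpert
      have h1 := sum_abs_mulVec_le (hAnn t) (hAcol t) (rwrSeqVar A α x0 t - xs)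
      rw [hstep, ← mul_add]
      simp only [Pi.smul_apply, smul_eq_mul, abs_mul, abs_of_pos hα0, ← Finset.mul_sum]
      refine mul_le_mul_of_nonneg_left (le_trans ?_ (add_le_add_left h1 _)) hα0.le
      rw [← Finset.sum_add_distrib]
      exact Finset.sum_le_sum fun v _ => abs_add_le _ _
    refine tendsto_pi_nhds.2 fun v => tendsto_iff_norm_sub_tendsto_zero.2 ?_
    refine squeeze_zero (fun t => norm_nonneg _) (fun t => ?_) herr
    exact Finset.single_le_sum (f := fun v => |(rwrSeqVar A α x0 t - xs) v|)
      (fun v _ => abs_nonneg _) (Finset.mem_univ v)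
end
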